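/- arXiv:2203.11577 — 3 statements merged into one kernel-verified Lean document; each statement's English description precedes it below -/
import Mathlib

section
/- Let 𝔸 be a relational structure with no algebraicity, let a ∈ A, and let F, H ⊆ A be finite subsets with a ∈ F ∩ H. Then there exists α ∈ Aut(𝔸) such that α(F) ∩ H = {a}. -/
open Set

variable {A : Type*} {ι : Type*}

/-- `f` is a homomorphism (endomorphism) of the relational structure `(A, rel)`. -/
def IsHom (ar : ι → ℕ) (rel : ∀ i, (Fin (ar i) → A) → Prop) (f : A → A) : Prop :=
  ∀ (i : ι) (x : Fin (ar i) → A), rel i x → rel i (f ∘ x)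

/-- `f` is a self-embedding of the relational structure `(A, rel)`. -/
def IsEmb (ar : ι → ℕ) (rel : ∀ i, (Fin (ar i) → A) → Prop) (f : A → A) : Prop :=
  Function.Injective f ∧ ∀ (i : ι) (x : Fin (ar i) → A), (rel i x ↔ rel i (f ∘ x))

/-- `f` is an automorphism of the relational structure `(A, rel)`. -/
def IsAuto (ar : ι → ℕ) (rel : ∀ i, (Fin (ar i) → A) → Prop) (f : A → A) : Prop :=
  Function.Bijective f ∧ ∀ (i : ι) (x : Fin (ar i) → A), (rel i x ↔ rel i (f ∘ x))

/-- `p` is an isomorphism between induced substructures when restricted to `D`. -/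
def IsPartialIsoOn (ar : ι → ℕ) (rel : ∀ i, (Fin (ar i) → A) → Prop)
    (D : Set A) (p : A → A) : Prop :=
  Set.InjOn p D ∧
    ∀ (i : ι) (x : Fin (ar i) → A), (∀ k, x k ∈ D) → (rel i x ↔ rel i (p ∘ x))

/-- `p` is a homomorphism between induced substructures when restricted to `D`. -/
def IsPartialHomOn (ar : ι → ℕ) (rel : ∀ i, (Fin (ar i) → A) → Prop)
    (D : Set A) (p : A → A) : Prop :=
  ∀ (i : ι) (x : Fin (ar i) → A), (∀ k, x k ∈ D) → rel i x → rel i (p ∘ x)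

/-- Every isomorphism between finite induced substructures extends to an automorphism. -/
def Homogeneous (ar : ι → ℕ) (rel : ∀ i, (Fin (ar i) → A) → Prop) : Prop :=
  ∀ (D : Finset A) (p : A → A), IsPartialIsoOn ar rel ↑D p →
    ∃ g : A → A, IsAuto ar rel g ∧ ∀ a ∈ D, g a = p a

/-- Every orbit on `A \ F` of the pointwise stabiliser of a finite set `F` is infinite. -/
def NoAlgebraicity (ar : ι → ℕ) (rel : ∀ i, (Fin (ar i) → A) → Prop) : Prop :=
  ∀ (F : Finset A) (a : A), a ∉ F →
    {b : A | ∃ g : A → A, IsAuto ar rel g ∧ (∀ x ∈ F, g x = x) ∧ g a = b}.Infinite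

/-- For every `k`, the action of the automorphism group on `k`-tuples has
finitely many orbits. -/
def OmegaCategorical (ar : ι → ℕ) (rel : ∀ i, (Fin (ar i) → A) → Prop) : Prop :=
  ∀ k : ℕ,
    (Set.range fun v : Fin k → A =>
      {w : Fin k → A | ∃ g : A → A, IsAuto ar rel g ∧ w = g ∘ v}).Finite

/-- The endomorphisms of `(A, rel)`, as a set of functions. -/
def endSet (ar : ι → ℕ) (rel : ∀ i, (Fin (ar i) → A) → Prop) : Set (A → A) :=
  {f : A → A | IsHom ar rel f}

/-- The self-embeddings of `(A, rel)`, as a set of functions. -/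
def embSet (ar : ι → ℕ) (rel : ∀ i, (Fin (ar i) → A) → Prop) : Set (A → A) :=
  {f : A → A | IsEmb ar rel f}

/-- The automorphisms of `(A, rel)`, as a set of functions. -/
def autSet (ar : ι → ℕ) (rel : ∀ i, (Fin (ar i) → A) → Prop) : Set (A → A) :=
  {f : A → A | IsAuto ar rel f}

/-- `(A, rel)` is arsfacere, witnessed by the relation symbol `E`. -/
def ArsfacereWith (ar : ι → ℕ) (rel : ∀ i, (Fin (ar i) → A) → Prop) (E : ι) : Prop :=
  (∀ x : A, ¬ rel E (fun _ => x)) ∧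
  ∀ (x : A) (F : Fin (ar E) → Finset A),
    (∀ i j : Fin (ar E), i ≠ j → ((F i : Set A) ∩ (F j : Set A)) = {x}) →
    ∃ f : A → A,
      Set.InjOn f (⋃ i, (F i : Set A)) ∧
      (∀ i, IsPartialIsoOn ar rel (F i : Set A) f) ∧
      ∀ y : Fin (ar E) → A, (∀ k, y k ∈ F k ∧ y k ≠ x) →
        ∃ σ : Equiv.Perm (Fin (ar E)), rel E (fun k => f (y (σ k)))

theorem IsAuto.comp {ar : ι → ℕ} {rel : ∀ i, (Fin (ar i) → A) → Prop} {f g : A → A}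
    (hf : IsAuto ar rel f) (hg : IsAuto ar rel g) : IsAuto ar rel (f ∘ g) :=
  ⟨hf.1.comp hg.1, fun i x => (hg.2 i x).trans (hf.2 i (g ∘ x))⟩

theorem isAuto_id (ar : ι → ℕ) (rel : ∀ i, (Fin (ar i) → A) → Prop) : IsAuto ar rel id :=
  ⟨Function.bijective_id, fun _ _ => Iff.rfl⟩

/-- Without algebraicity, a finite set `T` disjoint from a finite set `D` can be moved off any
finite set `H` by an automorphism fixing `D` pointwise. -/
theorem NoAlgebraicity.exists_isAuto_fixing_disjoint {ar : ι → ℕ}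
    {rel : ∀ i, (Fin (ar i) → A) → Prop} (noalg : NoAlgebraicity ar rel)
    (T D H : Finset A) (hTD : ∀ t ∈ T, t ∉ D) :
    ∃ g : A → A, IsAuto ar rel g ∧ (∀ x ∈ D, g x = x) ∧ ∀ t ∈ T, g t ∉ H := by
  classical
  induction hn : T.card generalizing T D with
  | zero =>
    obtain rfl := Finset.card_eq_zero.1 hn
    exact ⟨id, isAuto_id ar rel, fun _ _ => rfl, by simp⟩
  | succ n ih =>
    obtain ⟨t, T, htT, rfl, hT⟩ := Finset.card_eq_succ.1 hn
    obtain ⟨_, ⟨f, hf, hfD, rfl⟩, hft⟩ :=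
      (noalg D t (hTD t (Finset.mem_insert_self t T))).exists_notMem_finset H
    have hdisj : ∀ s ∈ T.image f, s ∉ insert (f t) D := by
      simp only [Finset.mem_image, Finset.mem_insert, not_or]
      rintro _ ⟨s, hs, rfl⟩
      refine ⟨fun h => htT (hf.1.1 h ▸ hs), fun h => ?_⟩
      have hsD : f s = s := hf.1.1 (hfD _ h)
      exact hTD s (Finset.mem_insert_of_mem hs) (hsD ▸ h)
    obtain ⟨g, hg, hgD, hgT⟩ := ih (T.image f) (insert (f t) D) hdisj
      ((Finset.card_image_of_injective T hf.1.1).trans hT)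
    refine ⟨g ∘ f, hg.comp hf, fun x hx => ?_, fun s hs => ?_⟩
    · rw [Function.comp_apply, hfD x hx, hgD x (Finset.mem_insert_of_mem hx)]
    · rcases Finset.mem_insert.1 hs with rfl | hs
      · rwa [Function.comp_apply, hgD _ (Finset.mem_insert_self _ D)]
      · exact hgT _ (Finset.mem_image_of_mem f hs)

theorem exists_automorphism_separating_finite_sets
    (ar : ι → ℕ) (rel : ∀ i, (Fin (ar i) → A) → Prop)
    (noalg : NoAlgebraicity ar rel)
    (a : A) (F H : Finset A) (haF : a ∈ F) (haH : a ∈ H) :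
    ∃ α : A → A, IsAuto ar rel α ∧ (α '' ↑F) ∩ ↑H = {a} := by
  classical
  obtain ⟨g, hg, hga, hgF⟩ :=
    noalg.exists_isAuto_fixing_disjoint (F.erase a) {a} H (by simp +contextual)
  have hga : g a = a := hga a (Finset.mem_singleton_self a)
  refine ⟨g, hg, Set.Subset.antisymm ?_ ?_⟩
  · rintro _ ⟨⟨x, hx, rfl⟩, hxH⟩
    by_cases hxa : x = a
    · exact hxa ▸ hga
    · exact absurd hxH (hgF x (Finset.mem_erase.2 ⟨hxa, hx⟩))
  · rintro _ rfl
    exact ⟨⟨_, haF, hga⟩, haH⟩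
end

section
/- Let R be the random graph. Then the Zariski topology on the endomorphism monoid End(R) coincides with the pointwise topology. Consequently, every Hausdorff semigroup topology on End(R) contains the pointwise topology. -/
variable {G : Type*}

/-- The extension property characterising the random graph: for all disjoint
finite sets `U`, `V` of vertices there is a vertex outside `U ∪ V` adjacent to
everything in `U` and to nothing in `V`. -/
def ExtensionProperty (adj : G → G → Prop) : Prop :=
  ∀ U V : Finset G, (∀ x ∈ U, x ∉ V) →
    ∃ w : G, w ∉ U ∧ w ∉ V ∧ (∀ u ∈ U, adj w u) ∧ (∀ v ∈ V, ¬ adj w v)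

/-- The endomorphism monoid of the graph `(G, adj)`, as a set of functions. -/
def graphEnd (adj : G → G → Prop) : Set (G → G) :=
  {f : G → G | ∀ x y : G, adj x y → adj (f x) (f y)}

theorem graphEnd_comp (adj : G → G → Prop) :
    ∀ f ∈ graphEnd adj, ∀ g ∈ graphEnd adj, g ∘ f ∈ graphEnd adj :=
  fun _ hf _ hg x y h => hg _ _ (hf x y h)

/-- The topology of pointwise convergence on a set `S` of self-maps of `X`,
where `X` carries the discrete topology. -/
def pointwiseTop (X : Type*) (S : Set (X → X)) : TopologicalSpace ↥S :=
  TopologicalSpace.generateFrom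
    {U : Set ↥S | ∃ x y : X, U = {f : ↥S | f.1 x = y}}

/-- Evaluation of the word `t₁ · s · t₂ · s ⋯ s · t_k` (with `t₁ = t`,
`[t₂, …, t_k] = ts` and multiplication being composition in diagrammatic
order) at `s`. -/
def polyEval {X : Type*} (t : X → X) (ts : List (X → X)) (s : X → X) : X → X :=
  ts.foldl (fun acc u => u ∘ s ∘ acc) t

/-- The Zariski topology on a set `S` of self-maps of `X` (a monoid under
composition in diagrammatic order). -/
def zariskiTop (X : Type*) (S : Set (X → X)) : TopologicalSpace ↥S :=
  TopologicalSpace.generateFrom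
    {U : Set ↥S | ∃ (t : ↥S) (ts : List ↥S) (u : ↥S) (us : List ↥S),
      U = {s : ↥S | polyEval t.1 (ts.map Subtype.val) s.1
              ≠ polyEval u.1 (us.map Subtype.val) s.1}}

/-- Every vertex of a graph with the extension property lies in an infinite clique. -/
theorem ExtensionProperty.exists_clique {adj : G → G → Prop} (hsymm : Symmetric adj)
    (hext : ExtensionProperty adj) (x : G) :
    ∃ c : ℕ → G, c 0 = x ∧ ∀ m n, m ≠ n → adj (c m) (c n) := by
  classical
  have : Std.Symm adj := ⟨fun _ _ h => hsymm h⟩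
  obtain ⟨f, hf, hpair⟩ := exists_seq_of_forall_finset_exists' (fun z => adj x z) adj
    (fun s _ => by
      obtain ⟨w, -, -, hw, -⟩ := hext (insert x s) ∅ (by simp)
      exact ⟨w, hsymm (hw x (by simp)), fun z hz => hsymm (hw z (by simp [hz]))⟩)
  refine ⟨fun n => n.casesOn x f, rfl, ?_⟩
  rintro (_ | m) (_ | n) h
  · exact absurd rfl h
  · exact hf n
  · exact hsymm (hf m)
  · exact hpair fun hmn => h (congrArg Nat.succ hmn)

/-- An injection into a clique is a homomorphism. -/
theorem clique_comp_mem_graphEnd {adj : G → G → Prop} (hirr : Irreflexive adj) {c : ℕ → G}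
    (hc : ∀ m n, m ≠ n → adj (c m) (c n)) {k : G → ℕ} (hk : Function.Injective k) :
    (fun z => c (k z)) ∈ graphEnd adj := by
  intro a b hab
  refine hc _ _ fun h => ?_
  obtain rfl := hk h
  exact hirr a hab

/-- There are two endomorphisms which differ exactly at `y`. -/
theorem exists_graphEnd_ne_iff [Countable G] {adj : G → G → Prop}
    (hsymm : Symmetric adj) (hirr : Irreflexive adj) (hext : ExtensionProperty adj) (y : G) :
    ∃ f f' : ↥(graphEnd adj), ∀ z, f.1 z ≠ f'.1 z ↔ z = y := by
  classical
  obtain ⟨c, -, hc⟩ := hext.exists_clique hsymm y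
  obtain ⟨e, he⟩ := exists_injective_nat G
  refine ⟨⟨fun z => c (2 * e z), clique_comp_mem_graphEnd hirr hc fun a b h => he (by grind)⟩,
    ⟨fun z => c (if z = y then 1 else 2 * e z),
      clique_comp_mem_graphEnd hirr hc fun a b h => ?_⟩, fun z => ?_⟩
  · by_cases ha : a = y <;> by_cases hb : b = y <;> simp only [ha, hb, if_true, if_false] at h ⊢
    · omega
    · omega
    · exact he (by omega)
  · by_cases hz : z = y
    · simp only [hz, if_true, iff_true]
      intro h
      have hadj := hc (2 * e y) 1 (by omega)
      rw [h] at hadj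
      exact hirr _ hadj
    · simp [hz]

/-- There are two endomorphisms fixing `x` whose images, away from `x`, are completely joined. -/
theorem exists_graphEnd_joined [Countable G] {adj : G → G → Prop}
    (hsymm : Symmetric adj) (hirr : Irreflexive adj) (hext : ExtensionProperty adj) (x : G) :
    ∃ g g' : ↥(graphEnd adj), g.1 x = x ∧ g'.1 x = x ∧
      ∀ a b, a ≠ x → b ≠ x → adj (g.1 a) (g'.1 b) := by
  classical
  obtain ⟨c, hc0, hc⟩ := hext.exists_clique hsymm x
  obtain ⟨e, he⟩ := exists_injective_nat G
  have hinj (i : ℕ) : Function.Injective fun z => if z = x then 0 else 2 * e z + (i + 1) := by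
    intro a b h
    by_cases ha : a = x <;> by_cases hb : b = x <;>
      simp only [ha, hb, if_true, if_false] at h ⊢
    · omega
    · omega
    · exact he (by omega)
  refine ⟨⟨_, clique_comp_mem_graphEnd hirr hc (hinj 0)⟩,
    ⟨_, clique_comp_mem_graphEnd hirr hc (hinj 1)⟩, by simp [hc0], by simp [hc0], ?_⟩
  intro a b ha hb
  simp only [ha, hb, if_false]
  exact hc _ _ (by omega)

theorem isOpen_zariskiTop_setOf_mem_range [Countable G] {adj : G → G → Prop}
    (hsymm : Symmetric adj) (hirr : Irreflexive adj) (hext : ExtensionProperty adj)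
    (g : ↥(graphEnd adj)) (y : G) :
    @IsOpen _ (zariskiTop G (graphEnd adj)) {s | ∃ z, s.1 (g.1 z) = y} := by
  obtain ⟨f, f', hff⟩ := exists_graphEnd_ne_iff hsymm hirr hext y
  refine TopologicalSpace.isOpen_generateFrom_of_mem ⟨g, [f], g, [f'], ?_⟩
  ext s
  simp only [Set.mem_setOf_eq, polyEval, List.map_cons, List.map_nil, List.foldl_cons,
    List.foldl_nil, Function.ne_iff, Function.comp_apply, hff]

theorem zariskiTop_le_pointwiseTop [Countable G] {adj : G → G → Prop}
    (hsymm : Symmetric adj) (hirr : Irreflexive adj) (hext : ExtensionProperty adj) :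
    zariskiTop G (graphEnd adj) ≤ pointwiseTop G (graphEnd adj) := by
  refine le_generateFrom ?_
  rintro _ ⟨x, y, rfl⟩
  obtain ⟨g, g', hg, hg', hadj⟩ := exists_graphEnd_joined hsymm hirr hext x
  let := zariskiTop G (graphEnd adj)
  have h := (isOpen_zariskiTop_setOf_mem_range hsymm hirr hext g y).inter
    (isOpen_zariskiTop_setOf_mem_range hsymm hirr hext g' y)
  convert h using 1
  ext s
  simp only [Set.mem_setOf_eq, Set.mem_inter_iff]
  refine ⟨fun hs => ⟨⟨x, by rw [hg, hs]⟩, ⟨x, by rw [hg', hs]⟩⟩, ?_⟩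
  rintro ⟨⟨a, ha⟩, ⟨b, hb⟩⟩
  by_cases hax : a = x
  · rwa [hax, hg] at ha
  by_cases hbx : b = x
  · rwa [hbx, hg'] at hb
  have hyy := s.2 _ _ (hadj a b hax hbx)
  rw [ha, hb] at hyy
  exact absurd hyy (hirr y)

section SemigroupTopology

variable {X : Type*} {S : Set (X → X)}

theorem exists_continuous_foldl_comp [TopologicalSpace ↥S]
    (hS : ∀ f ∈ S, ∀ g ∈ S, g ∘ f ∈ S)
    (hmul : Continuous fun p : ↥S × ↥S =>
      (⟨p.2.1 ∘ p.1.1, hS p.1.1 p.1.2 p.2.1 p.2.2⟩ : ↥S))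
    (ts : List ↥S) {F : ↥S → ↥S} (hF : Continuous F) :
    ∃ P : ↥S → ↥S, Continuous P ∧ ∀ s, (P s).1 =
      (ts.map Subtype.val).foldl (fun acc u => u ∘ s.1 ∘ acc) (F s).1 := by
  induction ts generalizing F with
  | nil => exact ⟨F, hF, fun s => rfl⟩
  | cons u us ih =>
    obtain ⟨P, hP, h⟩ := ih
      (hmul.comp ((hmul.comp (hF.prodMk continuous_id)).prodMk (continuous_const (y := u))))
    exact ⟨P, hP, h⟩

/-- Every Hausdorff semigroup topology contains the Zariski topology. -/
theorem le_zariskiTop [τ : TopologicalSpace ↥S] [T2Space ↥S]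
    (hS : ∀ f ∈ S, ∀ g ∈ S, g ∘ f ∈ S)
    (hmul : Continuous fun p : ↥S × ↥S =>
      (⟨p.2.1 ∘ p.1.1, hS p.1.1 p.1.2 p.2.1 p.2.2⟩ : ↥S)) :
    τ ≤ zariskiTop X S := by
  refine le_generateFrom ?_
  rintro _ ⟨t, ts, u, us, rfl⟩
  obtain ⟨P, hP, hPs⟩ := exists_continuous_foldl_comp hS hmul ts (continuous_const (y := t))
  obtain ⟨Q, hQ, hQs⟩ := exists_continuous_foldl_comp hS hmul us (continuous_const (y := u))
  convert isOpen_ne_fun hP hQ using 1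
  ext s
  simp only [Set.mem_setOf_eq, polyEval, ← hPs, ← hQs, ne_eq, Subtype.ext_iff]

theorem isOpen_pointwiseTop_setOf_eq (x y : X) :
    @IsOpen _ (pointwiseTop X S) {f : ↥S | f.1 x = y} :=
  TopologicalSpace.isOpen_generateFrom_of_mem ⟨x, y, rfl⟩

theorem t2Space_pointwiseTop : @T2Space _ (pointwiseTop X S) := by
  let := pointwiseTop X S
  refine ⟨fun f g hfg => ?_⟩
  obtain ⟨x, hx⟩ := Function.ne_iff.1 fun h => hfg (Subtype.ext h)
  exact ⟨_, _, isOpen_pointwiseTop_setOf_eq x (f.1 x), isOpen_pointwiseTop_setOf_eq x (g.1 x),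
    rfl, rfl, Set.disjoint_left.2 fun h hf hg => hx (hf.symm.trans hg)⟩

theorem pointwiseTop_le_zariskiTop (hS : ∀ f ∈ S, ∀ g ∈ S, g ∘ f ∈ S) :
    pointwiseTop X S ≤ zariskiTop X S := by
  let := pointwiseTop X S
  have := t2Space_pointwiseTop (S := S)
  refine le_zariskiTop hS (continuous_generateFrom_iff.2 ?_)
  rintro _ ⟨x, y, rfl⟩
  convert isOpen_iUnion fun z => (isOpen_pointwiseTop_setOf_eq (S := S) x z).prod
    (isOpen_pointwiseTop_setOf_eq (S := S) z y) using 1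
  ext p
  simp

end SemigroupTopology

theorem randomGraph_zariski_eq_pointwise
    [Countable G] (adj : G → G → Prop)
    (hsymm : Symmetric adj) (hirr : Irreflexive adj)
    (hext : ExtensionProperty adj) :
    zariskiTop G (graphEnd adj) = pointwiseTop G (graphEnd adj) ∧
      ∀ τ : TopologicalSpace ↥(graphEnd adj),
        @T2Space ↥(graphEnd adj) τ →
        @Continuous (↥(graphEnd adj) × ↥(graphEnd adj)) ↥(graphEnd adj)
          (@instTopologicalSpaceProd ↥(graphEnd adj) ↥(graphEnd adj) τ τ) τ
          (fun p => ⟨p.2.1 ∘ p.1.1, graphEnd_comp adj p.1.1 p.1.2 p.2.1 p.2.2⟩) →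
        ∀ U : Set ↥(graphEnd adj),
          @IsOpen ↥(graphEnd adj) (pointwiseTop G (graphEnd adj)) U →
          @IsOpen ↥(graphEnd adj) τ U := by
  have heq : zariskiTop G (graphEnd adj) = pointwiseTop G (graphEnd adj) :=
    le_antisymm (zariskiTop_le_pointwiseTop hsymm hirr hext)
      (pointwiseTop_le_zariskiTop (graphEnd_comp adj))
  refine ⟨heq, fun τ hT2 hmul U hU => ?_⟩
  rw [← heq] at hU
  exact le_zariskiTop (graphEnd_comp adj) hmul U hU
end

section
/- Let Inj(ℕ) be the monoid of all injective functions ℕ → ℕ under composition, with the pointwise topology. Let S be a submonoid of Inj(ℕ) which is closed in the pointwise topology, and suppose that the group of units of S is not closed in S (with the pointwise topology). Then S admits at least two distinct Polish semigroup topologies. -/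
/-- `τ` is a Polish semigroup topology on the set `S` of self-maps of `X`
(a semigroup under composition in diagrammatic order, `hS` witnessing closure
under composition): `τ` is Polish and composition is continuous. -/
def IsPolishSemigroupTop {X : Type*} {S : Set (X → X)}
    (hS : ∀ f ∈ S, ∀ g ∈ S, g ∘ f ∈ S) (τ : TopologicalSpace ↥S) : Prop :=
  @PolishSpace ↥S τ ∧
    @Continuous (↥S × ↥S) ↥S (@instTopologicalSpaceProd ↥S ↥S τ τ) τ
      (fun p => ⟨p.2.1 ∘ p.1.1, hS p.1.1 p.1.2 p.2.1 p.2.2⟩)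

/-- The monoid of all injective self-maps of `ℕ`, as a set of functions. -/
def injSet : Set (ℕ → ℕ) := {f : ℕ → ℕ | Function.Injective f}

theorem pointwiseTop_eq_induced (X : Type*) [TopologicalSpace X] [DiscreteTopology X]
    (S : Set (X → X)) :
    pointwiseTop X S = TopologicalSpace.induced Subtype.val Pi.topologicalSpace := by
  apply le_antisymm
  · let _ : TopologicalSpace S := pointwiseTop X S
    refine continuous_iff_le_induced.1 (continuous_pi fun x => ?_)
    refine continuous_discrete_rng.2 fun y => ?_
    exact TopologicalSpace.isOpen_generateFrom_of_mem ⟨x, y, rfl⟩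
  · refine le_generateFrom ?_
    rintro _ ⟨x, y, rfl⟩
    exact ⟨(fun f => f x) ⁻¹' {y}, (isOpen_discrete {y}).preimage (continuous_apply x), rfl⟩
theorem polishSpace_induced {α β : Type*} [TopologicalSpace β] [PolishSpace β] {F : α → β}
    (hF : Function.Injective F) (hc : IsClosed (Set.range F)) :
    @PolishSpace α (TopologicalSpace.induced F ‹_›) := by
  let _ : TopologicalSpace α := TopologicalSpace.induced F ‹_›
  exact Topology.IsClosedEmbedding.polishSpace ⟨⟨⟨rfl⟩, hF⟩, hc⟩

theorem continuous_induced_of_semiconj {α β : Type*} [TopologicalSpace β] (F : α → β)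
    (m : α × α → α) (n : β × β → β) (hn : Continuous n)
    (h : ∀ p, F (m p) = n (F p.1, F p.2)) :
    @Continuous (α × α) α
      (@instTopologicalSpaceProd α α (TopologicalSpace.induced F ‹_›)
        (TopologicalSpace.induced F ‹_›))
      (TopologicalSpace.induced F ‹_›) m := by
  let _ : TopologicalSpace α := TopologicalSpace.induced F ‹_›
  have hF : Continuous F := continuous_induced_dom
  refine continuous_induced_rng.2 ?_
  have : F ∘ m = fun p => n (F p.1, F p.2) := funext h
  rw [this]
  fun_prop

theorem continuous_eval_discrete {X Y : Type*} [TopologicalSpace X] [DiscreteTopology X]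
    [TopologicalSpace Y] : Continuous fun p : X × (X → Y) => p.2 p.1 :=
  continuous_prod_of_discrete_left.2 fun x => continuous_apply x

theorem continuous_comp_pi_discrete :
    Continuous fun p : (ℕ → ℕ) × (ℕ → ℕ) => p.2 ∘ p.1 :=
  continuous_pi fun x => continuous_eval_discrete.comp
    (((continuous_apply x).comp continuous_fst).prodMk continuous_snd)

/-- The partial inverse of `f`, with value `x + 1` at `f x` and `0` off the range of `f`. -/
noncomputable def shiftedInv (f : ℕ → ℕ) (y : ℕ) : ℕ :=
  (Function.partialInv f y).elim 0 (· + 1)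

theorem shiftedInv_eq_succ_iff {f : ℕ → ℕ} (hf : Function.Injective f) {x y : ℕ} :
    shiftedInv f y = x + 1 ↔ f x = y := by
  rw [← hf.isPartialInv x y, shiftedInv]
  cases Function.partialInv f y <;> simp

theorem eq_shiftedInv {f h : ℕ → ℕ} (hf : Function.Injective f)
    (hh : ∀ x y, h y = x + 1 ↔ f x = y) : h = shiftedInv f := by
  have key : ∀ x y, h y = x + 1 ↔ shiftedInv f y = x + 1 := fun x y =>
    (hh x y).trans (shiftedInv_eq_succ_iff hf).symm
  funext y
  rcases hy : h y with _ | x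
  · rcases hs : shiftedInv f y with _ | x
    · rfl
    · rw [(key x y).2 hs] at hy
      exact hy.symm
  · exact ((key x y).1 hy).symm

theorem shiftedInv_comp {f g : ℕ → ℕ} (hf : Function.Injective f) (hg : Function.Injective g) :
    shiftedInv (g ∘ f) =
      fun y => Nat.casesOn (motive := fun _ => ℕ) (shiftedInv g y) 0 (shiftedInv f) := by
  refine (eq_shiftedInv (hg.comp hf) fun x y => ?_).symm
  rcases hy : shiftedInv g y with _ | z
  · simp only [Function.comp_apply]
    rw [← shiftedInv_eq_succ_iff hg, hy]
    simp
  · rw [shiftedInv_eq_succ_iff hg] at hy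
    subst hy
    simp [shiftedInv_eq_succ_iff hf, hg.eq_iff]

/-- An injection together with its partial inverse. -/
noncomputable def withInv (S : Set (ℕ → ℕ)) (f : S) : (ℕ → ℕ) × (ℕ → ℕ) :=
  (f.1, shiftedInv f.1)

theorem isClosed_range_withInv {S : Set (ℕ → ℕ)} (hSinj : S ⊆ injSet) (hS : IsClosed S) :
    IsClosed (Set.range (withInv S)) := by
  have hrange : Set.range (withInv S) =
      {p | p.1 ∈ S} ∩ ⋂ x : ℕ, ⋂ y : ℕ, {p | p.2 y = x + 1 ↔ p.1 x = y} := by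
    ext ⟨f, h⟩
    simp only [Set.mem_range, Set.mem_inter_iff, Set.mem_iInter, Set.mem_ofPred_eq]
    constructor
    · rintro ⟨g, hg⟩
      obtain ⟨rfl, rfl⟩ := Prod.mk.inj hg
      exact ⟨g.2, fun x y => shiftedInv_eq_succ_iff (hSinj g.2)⟩
    · rintro ⟨hf, hh⟩
      exact ⟨⟨f, hf⟩, Prod.ext rfl (eq_shiftedInv (hSinj hf) hh).symm⟩
  rw [hrange]
  refine (hS.preimage continuous_fst).inter (isClosed_iInter fun x => isClosed_iInter fun y => ?_)
  exact (isClosed_discrete {q : ℕ × ℕ | q.1 = x + 1 ↔ q.2 = y}).preimage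
    (f := fun p : (ℕ → ℕ) × (ℕ → ℕ) => (p.2 y, p.1 x)) (by fun_prop)

theorem isClosed_units_withInv {S : Set (ℕ → ℕ)} (hSinj : S ⊆ injSet) (hS : IsClosed S) :
    @IsClosed S (TopologicalSpace.induced (withInv S) inferInstance)
      {f : S | ∃ g ∈ S, g ∘ f.1 = id ∧ f.1 ∘ g = id} := by
  let _ : TopologicalSpace S := TopologicalSpace.induced (withInv S) inferInstance
  have hF : Continuous (withInv S) := continuous_induced_dom
  have hunits : {f : S | ∃ g ∈ S, g ∘ f.1 = id ∧ f.1 ∘ g = id} =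
      withInv S ⁻¹' ((⋂ y : ℕ, {p | p.2 y ≠ 0}) ∩ {p | (fun y => p.2 y - 1) ∈ S}) := by
    ext f
    have hf := hSinj f.2
    simp only [Set.mem_ofPred_eq, Set.mem_preimage, Set.mem_inter_iff, Set.mem_iInter, withInv]
    constructor
    · rintro ⟨g, hg, -, hfg⟩
      have hinv : ∀ y, shiftedInv f.1 y = g y + 1 := fun y =>
        (shiftedInv_eq_succ_iff hf).2 (congrFun hfg y)
      simpa [hinv] using hg
    · rintro ⟨hne, hg⟩
      have hfg : ∀ y, f.1 (shiftedInv f.1 y - 1) = y := fun y =>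
        (shiftedInv_eq_succ_iff hf).1 (Nat.succ_pred_eq_of_ne_zero (hne y)).symm
      exact ⟨_, hg, funext fun x => hf (hfg (f.1 x)), funext hfg⟩
  rw [hunits]
  refine IsClosed.preimage hF (IsClosed.inter (isClosed_iInter fun y => ?_) (hS.preimage ?_))
  · exact (isClosed_discrete {n : ℕ | n ≠ 0}).preimage
      (f := fun p : (ℕ → ℕ) × (ℕ → ℕ) => p.2 y) (by fun_prop)
  · exact continuous_pi fun y => (continuous_of_discreteTopology (f := fun n : ℕ => n - 1)).comp
      ((continuous_apply y).comp continuous_snd)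

theorem isPolishSemigroupTop_pointwiseTop {S : Set (ℕ → ℕ)}
    (hcomp : ∀ f ∈ S, ∀ g ∈ S, g ∘ f ∈ S) (hS : IsClosed S) :
    IsPolishSemigroupTop hcomp (pointwiseTop ℕ S) := by
  rw [pointwiseTop_eq_induced]
  exact ⟨polishSpace_induced Subtype.val_injective (by simpa using hS),
    continuous_induced_of_semiconj _ _ _ continuous_comp_pi_discrete fun _ => rfl⟩

theorem isPolishSemigroupTop_withInv {S : Set (ℕ → ℕ)} (hSinj : S ⊆ injSet)
    (hcomp : ∀ f ∈ S, ∀ g ∈ S, g ∘ f ∈ S) (hS : IsClosed S) :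
    IsPolishSemigroupTop hcomp (TopologicalSpace.induced (withInv S) inferInstance) := by
  refine ⟨polishSpace_induced (fun f g h => Subtype.ext (congrArg Prod.fst h))
    (isClosed_range_withInv hSinj hS), ?_⟩
  refine continuous_induced_of_semiconj _ _
    (fun p => (p.2.1 ∘ p.1.1, fun y => Nat.casesOn (motive := fun _ => ℕ) (p.2.2 y) 0 p.1.2)) ?_
    fun p => Prod.ext rfl (shiftedInv_comp (hSinj p.1.2) (hSinj p.2.2))
  refine (continuous_comp_pi_discrete.comp
    ((continuous_fst.comp continuous_fst).prodMk (continuous_fst.comp continuous_snd))).prodMk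
    (continuous_pi fun y => ?_)
  have hcases : Continuous fun q : ℕ × (ℕ → ℕ) => Nat.casesOn (motive := fun _ => ℕ) q.1 0 q.2 := by
    refine continuous_prod_of_discrete_left.2 fun n => ?_
    cases n with
    | zero => exact continuous_const
    | succ x => exact continuous_apply x
  exact hcases.comp (f := fun p : ((ℕ → ℕ) × (ℕ → ℕ)) × ((ℕ → ℕ) × (ℕ → ℕ)) =>
    (p.2.2 y, p.1.2)) (by fun_prop)

theorem isClosed_injSet : IsClosed injSet := by
  have hinj : injSet = ⋂ x : ℕ, ⋂ y : ℕ, {f | f x = f y → x = y} := by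
    ext f
    simp [injSet, Function.Injective]
  rw [hinj]
  refine isClosed_iInter fun x => isClosed_iInter fun y => ?_
  exact (isClosed_discrete {q : ℕ × ℕ | q.1 = q.2 → x = y}).preimage
    (f := fun f : ℕ → ℕ => (f x, f y)) (by fun_prop)

theorem closed_submonoid_of_inj_two_topologies
    (S : Set (ℕ → ℕ))
    (hSinj : S ⊆ injSet)
    (hid : id ∈ S)
    (hcomp : ∀ f ∈ S, ∀ g ∈ S, g ∘ f ∈ S)
    (hclosed : @IsClosed ↥injSet (pointwiseTop ℕ injSet)
      {f : ↥injSet | f.1 ∈ S})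
    (hunits : ¬ @IsClosed ↥S (pointwiseTop ℕ S)
      {f : ↥S | ∃ g ∈ S, g ∘ f.1 = id ∧ f.1 ∘ g = id}) :
    ∃ τ₁ τ₂ : TopologicalSpace ↥S, τ₁ ≠ τ₂ ∧
      IsPolishSemigroupTop hcomp τ₁ ∧ IsPolishSemigroupTop hcomp τ₂ := by
  have hS : IsClosed S := by
    rw [pointwiseTop_eq_induced] at hclosed
    have himage := isClosed_injSet.isClosedEmbedding_subtypeVal.isClosedMap _ hclosed
    rwa [show Subtype.val '' {f : injSet | f.1 ∈ S} = S from
      Subtype.image_preimage_coe injSet S |>.trans (Set.inter_eq_right.2 hSinj)] at himage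
  refine ⟨pointwiseTop ℕ S, TopologicalSpace.induced (withInv S) inferInstance, fun h => ?_,
    isPolishSemigroupTop_pointwiseTop hcomp hS, isPolishSemigroupTop_withInv hSinj hcomp hS⟩
  rw [h] at hunits
  exact hunits (isClosed_units_withInv hSinj hS)
end
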